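/- Let i be an integer with 1 ≤ i ≤ r−1. If every monomial x^m y^n in the G-basis B(G) with m + a·n ≡ i (mod r) satisfies m = 0 or n = 0 (i.e. is a pure power of x or of y), then the map Φ_i is surjective. -/

import Mathlib

/-- The `G`-basis `B(G)` for the cyclic group `C_{r,a}`: monomials `x^m y^n`
(identified with pairs `(m,n) ∈ ℕ × ℕ`) that are divisible by no nonconstant
`G`-invariant monomial, where `x^p y^q` is `G`-invariant iff `r ∣ p + a*q`. -/
def BG (r a : ℕ) : Set (ℕ × ℕ) :=
  {mn | ∀ p q : ℕ, (p, q) ≠ (0, 0) → r ∣ p + a * q → ¬(p ≤ mn.1 ∧ q ≤ mn.2)}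

/-- The `L`-space `L(G)`: the monomials `x^k` and `y^k` with `0 ≤ k ≤ r-1`. -/
def LG (r : ℕ) : Set (ℕ × ℕ) :=
  {mn | (mn.2 = 0 ∧ mn.1 ≤ r - 1) ∨ (mn.1 = 0 ∧ mn.2 ≤ r - 1)}

open MvPolynomial in
/-- The `ℂ`-algebra automorphism `g` of `ℂ[x,y]` with `g x = ε • x`, `g y = ε^a • y`. -/
noncomputable def gAut (ε : ℂ) (a : ℕ) :
    MvPolynomial (Fin 2) ℂ →ₐ[ℂ] MvPolynomial (Fin 2) ℂ :=
  aeval (fun j : Fin 2 => if j = 0 then C ε * X 0 else C (ε ^ a) * X 1)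

/-- The semi-invariants of weight `i`: `S_i = {f : g f = ε^i • f}`. -/
def Sset (ε : ℂ) (a : ℕ) (i : ℤ) : Set (MvPolynomial (Fin 2) ℂ) :=
  {f | gAut ε a f = (ε ^ i) • f}

/-- Surjectivity of the multiplication map `Φ_i : S_{-(a+1)} × S_i → S_{i-(a+1)}`:
`S_{i-(a+1)}` equals the `ℂ`-linear span of the products `f * h`. -/
def PhiSurj (ε : ℂ) (a : ℕ) (i : ℤ) : Prop :=
  Sset ε a (i - (a + 1)) =
    ↑(Submodule.span ℂ
      {p : MvPolynomial (Fin 2) ℂ |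
        ∃ f ∈ Sset ε a (-(a + 1)), ∃ h ∈ Sset ε a i, p = f * h})

open MvPolynomial in
theorem gAut_monomial (ε : ℂ) (a : ℕ) (s : Fin 2 →₀ ℕ) (c : ℂ) :
    gAut ε a (monomial s c) = ε ^ (s 0 + a * s 1) • monomial s c := by
  rw [smul_eq_C_mul, gAut, aeval_monomial, monomial_eq,
    Finsupp.prod_fintype _ _ (fun _ => pow_zero _), Finsupp.prod_fintype _ _ (fun _ => pow_zero _)]
  simp only [Fin.prod_univ_two, algebraMap_eq, if_true, one_ne_zero, if_false, mul_pow, map_mul,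
    map_pow, pow_add, pow_mul]
  ring

open MvPolynomial in
theorem coeff_gAut (ε : ℂ) (a : ℕ) (f : MvPolynomial (Fin 2) ℂ) (s : Fin 2 →₀ ℕ) :
    coeff s (gAut ε a f) = ε ^ (s 0 + a * s 1) * coeff s f := by
  induction f using MvPolynomial.induction_on' with
  | monomial t c =>
    rw [gAut_monomial, coeff_smul, smul_eq_mul, coeff_monomial]
    split_ifs with h
    · rw [h]
    · simp
  | add p q hp hq => rw [map_add, coeff_add, coeff_add, hp, hq, mul_add]

open MvPolynomial in
theorem monomial_mem_Sset {ε : ℂ} {a : ℕ} {i : ℤ} {s : Fin 2 →₀ ℕ} (c : ℂ)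
    (h : ε ^ (s 0 + a * s 1) = ε ^ i) : monomial s c ∈ Sset ε a i := by
  rw [Sset, Set.mem_ofPred_eq, gAut_monomial, h]

theorem mul_mem_Sset {ε : ℂ} (hε : ε ≠ 0) {a : ℕ} {i j : ℤ} {f h : MvPolynomial (Fin 2) ℂ}
    (hf : f ∈ Sset ε a i) (hh : h ∈ Sset ε a j) : f * h ∈ Sset ε a (i + j) := by
  simp only [Sset, Set.mem_ofPred_eq] at *
  rw [map_mul, hf, hh, zpow_add₀ hε, smul_mul_smul_comm]

theorem span_subset_Sset {ε : ℂ} {a : ℕ} {i : ℤ} {s : Set (MvPolynomial (Fin 2) ℂ)}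
    (hs : s ⊆ Sset ε a i) : (Submodule.span ℂ s : Set (MvPolynomial (Fin 2) ℂ)) ⊆ Sset ε a i := by
  intro p hp
  induction hp using Submodule.span_induction with
  | mem x hx => exact hs hx
  | zero => simp [Sset]
  | add x y _ _ hx hy =>
    simp only [Sset, Set.mem_ofPred_eq] at *
    rw [map_add, hx, hy, smul_add]
  | smul c x _ hx =>
    simp only [Sset, Set.mem_ofPred_eq] at *
    rw [map_smul, hx, smul_comm]

/-- A monomial outside `B(G)` divisible by `xy` is divisible by an invariant monomial that is
itself divisible by `xy`. -/
theorem exists_invariant_of_notMem_BG {r a : ℕ} (hr : 2 ≤ r) (ha1 : 1 ≤ a) (ha2 : a ≤ r - 1)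
    (hgcd : Nat.Coprime a r) {m n : ℕ} (hm : 0 < m) (hn : 0 < n) (h : (m, n) ∉ BG r a) :
    ∃ u v : ℕ, 0 < u ∧ 0 < v ∧ u ≤ m ∧ v ≤ n ∧ r ∣ u + a * v := by
  simp only [BG, Set.mem_ofPred_eq, not_forall, not_not] at h
  obtain ⟨u, v, hne, hdvd, hum, hvn⟩ := h
  rcases Nat.eq_zero_or_pos v with rfl | hv
  · have hu : 0 < u := Nat.pos_of_ne_zero fun h0 => hne (by rw [h0])
    have hru : r ≤ u := Nat.le_of_dvd hu (by simpa using hdvd)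
    exact ⟨r - a, 1, by omega, one_pos, by omega, hn, by
      rw [mul_one, Nat.sub_add_cancel (by omega)]⟩
  rcases Nat.eq_zero_or_pos u with rfl | hu
  · have hrv : r ≤ v := Nat.le_of_dvd hv
      (hgcd.symm.dvd_of_dvd_mul_left (by simpa using hdvd))
    obtain ⟨w, hwr, hw⟩ := Nat.exists_mul_mod_eq_of_coprime (r - 1) hgcd (by omega)
    have hdw : r ∣ 1 + a * w := by
      refine Nat.dvd_of_mod_eq_zero ?_
      rw [Nat.add_mod, hw, Nat.add_mod_mod, Nat.mod_add_mod, Nat.add_sub_cancel' (by omega),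
        Nat.mod_self]
    refine ⟨1, w, one_pos, Nat.pos_of_ne_zero ?_, hm, by omega, hdw⟩
    rintro rfl
    exact absurd (Nat.le_of_dvd one_pos (by simpa using hdw)) (by omega)
  · exact ⟨u, v, hu, hv, hum, hvn, hdvd⟩

/-- if every monomial in `B(G)` of weight `≡ i (mod r)` is a pure power
of `x` or of `y`, then `Φ_i` is surjective. -/
theorem stmt_8 (r a : ℕ) (hr : 2 ≤ r) (ha1 : 1 ≤ a) (ha2 : a ≤ r - 1)
    (hgcd : Nat.Coprime a r) (ε : ℂ) (hε : IsPrimitiveRoot ε r)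
    (i : ℕ) (hi1 : 1 ≤ i) (hi2 : i ≤ r - 1)
    (hpure : ∀ m n : ℕ, (m, n) ∈ BG r a →
      Int.ModEq (r : ℤ) ((m + a * n : ℕ) : ℤ) (i : ℤ) → m = 0 ∨ n = 0) :
    PhiSurj ε a (i : ℤ) := by
  have hr0 : r ≠ 0 := by omega
  have hε0 : ε ≠ 0 := hε.ne_zero hr0
  refine Set.Subset.antisymm ?_ (span_subset_Sset ?_)
  · intro f hf
    rw [f.as_sum]
    refine Submodule.sum_mem _ fun s hs => Submodule.subset_span ?_
    have hweight : ε ^ (s 0 + a * s 1) = ε ^ ((i : ℤ) - (a + 1)) := by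
      have := congrArg (MvPolynomial.coeff s) (Set.mem_ofPred_eq ▸ hf)
      rw [coeff_gAut, MvPolynomial.coeff_smul, smul_eq_mul] at this
      exact mul_right_cancel₀ (MvPolynomial.mem_support_iff.mp hs) this
    have hmod : (r : ℤ) ∣ i - (((s 0 + 1) + a * (s 1 + 1) : ℕ) : ℤ) := by
      rw [← hε.zpow_eq_one_iff_dvd]
      have : (i : ℤ) - (((s 0 + 1) + a * (s 1 + 1) : ℕ) : ℤ)
          = (i - (a + 1)) - ((s 0 + a * s 1 : ℕ) : ℤ) := by push_cast; ring
      rw [this, zpow_sub₀ hε0, zpow_natCast, hweight, div_self (zpow_ne_zero _ hε0)]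
    obtain ⟨u, v, hu, hv, hum, hvn, hdvd⟩ :=
      exists_invariant_of_notMem_BG hr ha1 ha2 hgcd (Nat.succ_pos (s 0)) (Nat.succ_pos (s 1))
        fun hB => by simpa using hpure _ _ hB (Int.modEq_iff_dvd.mpr hmod)
    let t : Fin 2 →₀ ℕ := Finsupp.equivFunOnFinite.symm ![u - 1, v - 1]
    have ht0 : t 0 = u - 1 := rfl
    have ht1 : t 1 = v - 1 := rfl
    have hts : t ≤ s := by
      intro j
      fin_cases j
      · change u - 1 ≤ s 0
        omega
      · change v - 1 ≤ s 1
        omega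
    have hinv : ε ^ (t 0 + a * t 1) = ε ^ (-((a : ℤ) + 1)) := by
      have hsum : u + a * v = (t 0 + a * t 1) + (a + 1) := by
        obtain ⟨u, rfl⟩ := Nat.exists_eq_add_of_lt hu
        obtain ⟨v, rfl⟩ := Nat.exists_eq_add_of_lt hv
        rw [ht0, ht1, Nat.add_sub_cancel, Nat.add_sub_cancel]
        ring
      have hone : ε ^ (u + a * v) = 1 := (hε.pow_eq_one_iff_dvd _).mpr hdvd
      rw [hsum, pow_add] at hone
      rw [zpow_neg]
      exact_mod_cast eq_inv_of_mul_eq_one_left hone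
    refine ⟨_, monomial_mem_Sset (s := t) 1 hinv, _,
      monomial_mem_Sset (s := s - t) (f.coeff s) ?_, ?_⟩
    · have hsplit : s 0 + a * s 1 = (t 0 + a * t 1) + ((s - t) 0 + a * (s - t) 1) := by
        conv_lhs => rw [← add_tsub_cancel_of_le hts]
        simp only [Finsupp.add_apply]
        ring
      rw [hsplit, pow_add, hinv, sub_eq_neg_add, zpow_add₀ hε0] at hweight
      exact mul_left_cancel₀ (zpow_ne_zero _ hε0) hweight
    · rw [MvPolynomial.monomial_mul, one_mul, add_tsub_cancel_of_le hts]
  · rintro _ ⟨f, hf, h, hh, rfl⟩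
    rw [sub_eq_neg_add]
    exact mul_mem_Sset hε0 hf hh
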